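/- arXiv:2404.17644 — 2 statements merged into one kernel-verified Lean document; each statement's English description precedes it below -/
import Mathlib

section
/- For fixed real thresholds h₁ and h₂, the function T(·; h₁, h₂) : (−1, 1) → ℝ given by T(σ; h₁, h₂) = ∫_{h₁}^∞ ∫_{h₂}^∞ (2π√(1−σ²))^{−1} exp(−(x² − 2σxy + y²)/(2(1−σ²))) dy dx is strictly monotonically increasing in σ on (−1, 1). -/
open Real Set

/-- The joint exceedance probability of a standard bivariate normal with correlation `σ`:
`T σ h₁ h₂ = P(X > h₁, Y > h₂)`. -/
noncomputable def bivariateNormalTail (σ h₁ h₂ : ℝ) : ℝ :=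
  ∫ x in Set.Ioi h₁, ∫ y in Set.Ioi h₂,
    (2 * Real.pi * Real.sqrt (1 - σ ^ 2))⁻¹ *
      Real.exp (-(x ^ 2 - 2 * σ * x * y + y ^ 2) / (2 * (1 - σ ^ 2)))

open MeasureTheory ProbabilityTheory

lemma gaussianReal_ne_zero_of_volume_ne_zero {s : Set ℝ} (hs : volume s ≠ 0) :
    gaussianReal 0 1 s ≠ 0 :=
  fun h => hs (gaussianReal_absolutelyContinuous' 0 one_ne_zero h)

/-- The upper tail function of the standard Gaussian is strictly decreasing. -/
lemma gaussianReal_real_Ioi_strictAnti :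
    StrictAnti fun u : ℝ => (gaussianReal 0 1).real (Ioi u) := by
  intro a b hab
  have h_union : Ioi a = Ioc a b ∪ Ioi b := (Ioc_union_Ioi_eq_Ioi hab.le).symm
  have h_disj : Disjoint (Ioc a b) (Ioi b) :=
    Set.disjoint_left.2 fun x hx hx' => (not_lt.2 hx.2) hx'
  have h_pos : 0 < (gaussianReal 0 1).real (Ioc a b) := by
    refine ENNReal.toReal_pos (gaussianReal_ne_zero_of_volume_ne_zero ?_) (measure_ne_top _ _)
    simpa using hab
  change (gaussianReal 0 1).real (Ioi b) < (gaussianReal 0 1).real (Ioi a)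
  rw [h_union, measureReal_union h_disj measurableSet_Ioi]
  linarith

/-- Standardizing a Gaussian tail probability. -/
lemma gaussianReal_Ioi_eq_standard {s : ℝ} (hs : 0 < s) (m h : ℝ) :
    gaussianReal m (s ^ 2).toNNReal (Ioi h) = gaussianReal 0 1 (Ioi ((h - m) / s)) := by
  have h_map : gaussianReal m (s ^ 2).toNNReal = (gaussianReal 0 1).map (fun z => m + s * z) := by
    have h_comp : (fun z : ℝ => m + s * z) = (m + ·) ∘ (s * ·) := rfl
    rw [h_comp, ← Measure.map_map (by fun_prop) (by fun_prop), gaussianReal_map_const_mul,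
      gaussianReal_map_const_add]
    congr 1
    · simp
    · ext
      simp [Real.coe_toNNReal _ (sq_nonneg s)]
  rw [h_map, Measure.map_apply (by fun_prop) measurableSet_Ioi]
  congr 1
  ext z
  simp only [mem_preimage, mem_Ioi, div_lt_iff₀ hs]
  constructor <;> intro hz <;> linarith

lemma sqrt_one_sub_sq_pos {σ : ℝ} (hσ : σ ∈ Ioo (-1 : ℝ) 1) : 0 < √(1 - σ ^ 2) :=
  Real.sqrt_pos.2 (by nlinarith [hσ.1, hσ.2])

/-- The conditional tail probability `P(Y > h | X = x)` of a standard bivariate normal vector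
`(X, Y)` with correlation `σ`. -/
noncomputable def condNormalTail (σ h x : ℝ) : ℝ :=
  (gaussianReal 0 1).real (Ioi ((h - σ * x) / √(1 - σ ^ 2)))

lemma condNormalTail_eq {σ : ℝ} (hσ : σ ∈ Ioo (-1 : ℝ) 1) (h x : ℝ) :
    condNormalTail σ h x = (gaussianReal (σ * x) (1 - σ ^ 2).toNNReal).real (Ioi h) := by
  have hs := sqrt_one_sub_sq_pos hσ
  have h_eq := gaussianReal_Ioi_eq_standard hs (σ * x) h
  rw [Real.sq_sqrt (Real.sqrt_pos.1 hs).le] at h_eq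
  simp only [condNormalTail, Measure.real, h_eq]

lemma condNormalTail_nonneg (σ h x : ℝ) : 0 ≤ condNormalTail σ h x :=
  measureReal_nonneg

lemma integrable_condNormalTail (σ h : ℝ) :
    Integrable (condNormalTail σ h) (gaussianReal 0 1) := by
  refine Integrable.of_bound (C := 1) ?_ (.of_forall fun x => ?_)
  · exact (gaussianReal_real_Ioi_strictAnti.antitone.measurable.comp
      (by fun_prop : Measurable fun x : ℝ => (h - σ * x) / √(1 - σ ^ 2))).aestronglyMeasurable
  · rw [Real.norm_of_nonneg (condNormalTail_nonneg σ h x)]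
    exact measureReal_le_one

/-- The total mass of the conditional tail does not depend on the correlation. -/
lemma integral_condNormalTail {σ : ℝ} (hσ : σ ∈ Ioo (-1 : ℝ) 1) (h : ℝ) :
    ∫ x, condNormalTail σ h x ∂gaussianReal 0 1 = (gaussianReal 0 1).real (Ioi h) := by
  have hv : 0 ≤ 1 - σ ^ 2 := (Real.sqrt_pos.1 (sqrt_one_sub_sq_pos hσ)).le
  have h_conv : ((gaussianReal 0 1).map (σ * ·)).conv (gaussianReal 0 (1 - σ ^ 2).toNNReal)
      = gaussianReal 0 1 := by
    rw [gaussianReal_map_const_mul, gaussianReal_conv_gaussianReal]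
    congr 1
    · simp
    · ext
      simp [Real.coe_toNNReal _ hv]
  have h_lint : ∫⁻ x, gaussianReal (σ * x) (1 - σ ^ 2).toNNReal (Ioi h) ∂gaussianReal 0 1
      = gaussianReal 0 1 (Ioi h) := by
    conv_rhs => rw [← h_conv]
    rw [Measure.conv, Measure.map_apply (by fun_prop) measurableSet_Ioi,
      Measure.prod_apply ((by fun_prop : Measurable fun p : ℝ × ℝ => p.1 + p.2) measurableSet_Ioi),
      lintegral_map (measurable_measure_prodMk_left
        ((by fun_prop : Measurable fun p : ℝ × ℝ => p.1 + p.2) measurableSet_Ioi)) (by fun_prop)]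
    refine lintegral_congr fun x => ?_
    have h_shift := gaussianReal_map_const_add (μ := 0) (v := (1 - σ ^ 2).toNNReal) (σ * x)
    rw [zero_add] at h_shift
    rw [← h_shift, Measure.map_apply (by fun_prop) measurableSet_Ioi]
    rfl
  rw [integral_eq_lintegral_of_nonneg_ae (.of_forall (condNormalTail_nonneg σ h))
    (integrable_condNormalTail σ h).aestronglyMeasurable, Measure.real, ← h_lint]
  congr 1
  refine lintegral_congr fun x => ?_
  rw [condNormalTail_eq hσ, Measure.real, ENNReal.ofReal_toReal (measure_ne_top _ _)]

lemma bivariateNormalTail_eq_setIntegral {σ : ℝ} (hσ : σ ∈ Ioo (-1 : ℝ) 1) (h₁ h₂ : ℝ) :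
    bivariateNormalTail σ h₁ h₂ = ∫ x in Ioi h₁, condNormalTail σ h₂ x ∂gaussianReal 0 1 := by
  have hs := sqrt_one_sub_sq_pos hσ
  have hv : 0 < 1 - σ ^ 2 := Real.sqrt_pos.1 hs
  rw [gaussianReal_of_var_ne_zero _ one_ne_zero,
    setIntegral_withDensity_eq_setIntegral_toReal_smul (measurable_gaussianPDF _ _)
      (.of_forall fun _ => gaussianPDF_lt_top) _ measurableSet_Ioi]
  refine integral_congr_ae (.of_forall fun x => ?_)
  simp only [toReal_gaussianPDF, smul_eq_mul]
  rw [condNormalTail_eq hσ, Measure.real, gaussianReal_apply_eq_integral _ (by simpa using hv),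
    ENNReal.toReal_ofReal (integral_nonneg fun y => gaussianPDFReal_nonneg _ _ _),
    ← integral_const_mul]
  refine integral_congr_ae (.of_forall fun y => ?_)
  simp only [gaussianPDFReal, Real.coe_toNNReal _ hv.le, NNReal.coe_one, mul_one, sub_zero]
  have h_exp : -(x ^ 2 - 2 * σ * x * y + y ^ 2) / (2 * (1 - σ ^ 2))
      = -x ^ 2 / 2 + -(y - σ * x) ^ 2 / (2 * (1 - σ ^ 2)) := by
    field_simp
    ring
  have h_sqrt : √(2 * π) * √(2 * π * (1 - σ ^ 2)) = 2 * π * √(1 - σ ^ 2) := by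
    rw [Real.sqrt_mul (by positivity : 0 ≤ 2 * π), ← mul_assoc,
      Real.mul_self_sqrt (by positivity)]
  rw [h_exp, Real.exp_add, ← h_sqrt, mul_inv]
  ring

lemma div_sqrt_one_sub_sq_strictMonoOn :
    StrictMonoOn (fun σ : ℝ => σ / √(1 - σ ^ 2)) (Ioo (-1) 1) := by
  intro σ hσ τ hτ hστ
  simp only [← Real.tan_arcsin]
  exact Real.tan_lt_tan_of_lt_of_lt_pi_div_two (Real.neg_pi_div_two_lt_arcsin.2 hσ.1)
    (Real.arcsin_lt_pi_div_two.2 hτ.2)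
    (Real.strictMonoOn_arcsin ⟨hσ.1.le, hσ.2.le⟩ ⟨hτ.1.le, hτ.2.le⟩ hστ)

lemma setIntegral_lt_setIntegral_of_forall_lt {α : Type*} [MeasurableSpace α] {μ : Measure α}
    {s : Set α} {f g : α → ℝ} (hs : MeasurableSet s) (hμ : μ s ≠ 0) (hf : IntegrableOn f s μ)
    (hg : IntegrableOn g s μ) (hfg : ∀ x ∈ s, f x < g x) :
    ∫ x in s, f x ∂μ < ∫ x in s, g x ∂μ := by
  rw [← sub_pos, ← integral_sub' hg hf,
    setIntegral_pos_iff_support_of_nonneg_ae _ (hg.sub hf), pos_iff_ne_zero]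
  · rwa [Set.inter_eq_self_of_subset_right]
    exact fun x hx => (sub_pos.2 (hfg x hx)).ne'
  · exact (ae_restrict_iff' hs).2 (.of_forall fun x hx => (sub_pos.2 (hfg x hx)).le)

/-- for fixed thresholds `h₁, h₂`, the map `σ ↦ T(σ; h₁, h₂)` is strictly
monotonically increasing on `(-1, 1)`. -/
theorem bivariateNormalTail_strictMonoOn (h₁ h₂ : ℝ) :
    StrictMonoOn (fun σ => bivariateNormalTail σ h₁ h₂) (Set.Ioo (-1 : ℝ) 1) := by
  intro σ hσ τ hτ hστ
  simp only [bivariateNormalTail_eq_setIntegral hσ, bivariateNormalTail_eq_setIntegral hτ]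
  have h_slope := div_sqrt_one_sub_sq_strictMonoOn hσ hτ hστ
  have h_affine : ∀ ρ x : ℝ, (h₂ - ρ * x) / √(1 - ρ ^ 2)
      = h₂ / √(1 - ρ ^ 2) - ρ / √(1 - ρ ^ 2) * x := fun ρ x => by ring
  simp only at h_slope
  have h_int := fun (ρ : ℝ) => integrable_condNormalTail ρ h₂
  rcases le_or_gt ((h₂ - τ * h₁) / √(1 - τ ^ 2)) ((h₂ - σ * h₁) / √(1 - σ ^ 2)) with hc | hc
  · refine setIntegral_lt_setIntegral_of_forall_lt measurableSet_Ioi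
      (gaussianReal_ne_zero_of_volume_ne_zero (by simp)) (h_int σ).integrableOn (h_int τ).integrableOn
      fun x hx => gaussianReal_real_Ioi_strictAnti ?_
    rw [h_affine, h_affine] at hc ⊢
    nlinarith [mul_pos (sub_pos.2 h_slope) (sub_pos.2 (mem_Ioi.1 hx))]
  · have h_lt : ∫ x in Iic h₁, condNormalTail τ h₂ x ∂gaussianReal 0 1
        < ∫ x in Iic h₁, condNormalTail σ h₂ x ∂gaussianReal 0 1 := by
      refine setIntegral_lt_setIntegral_of_forall_lt measurableSet_Iic
        (gaussianReal_ne_zero_of_volume_ne_zero (by simp)) (h_int τ).integrableOn (h_int σ).integrableOn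
        fun x hx => gaussianReal_real_Ioi_strictAnti ?_
      rw [h_affine, h_affine] at hc ⊢
      nlinarith [mul_nonneg (sub_pos.2 h_slope).le (sub_nonneg.2 (mem_Iic.1 hx))]
    have h_total := fun (ρ : ℝ) (hρ : ρ ∈ Ioo (-1 : ℝ) 1) =>
      (integral_add_compl (measurableSet_Iic (a := h₁)) (h_int ρ)).trans
        (integral_condNormalTail hρ h₂)
    simp only [compl_Iic] at h_total
    linarith [h_total σ hσ, h_total τ hτ]
end

section
/- For fixed real h₁, h₂ and every σ ∈ (−1, 1), the function σ ↦ T(σ; h₁, h₂) is differentiable and its derivative equals the bivariate normal density evaluated at (h₁, h₂): ∂T/∂σ (σ; h₁, h₂) = (2π√(1−σ²))^{−1} · exp(−(h₁² − 2σh₁h₂ + h₂²)/(2(1−σ²))). In particular this derivative is strictly positive for all σ ∈ (−1, 1). -/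
open Real Set

open MeasureTheory Filter Topology

lemma integrable_exp_neg_sq_div_two : Integrable fun t : ℝ => Real.exp (-t ^ 2 / 2) := by
  convert integrable_exp_neg_mul_sq (b := 1 / 2) (by norm_num) using 3
  ring

lemma integrable_mul_exp_neg_sq_div_two : Integrable fun t : ℝ => t * Real.exp (-t ^ 2 / 2) := by
  convert integrable_mul_exp_neg_mul_sq (b := 1 / 2) (by norm_num) using 4
  ring

/-- The unnormalized upper tail of the standard normal distribution. -/
noncomputable def gaussianTail (u : ℝ) : ℝ :=
  ∫ t in Set.Ioi u, Real.exp (-t ^ 2 / 2)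

lemma hasDerivAt_gaussianTail (u : ℝ) :
    HasDerivAt gaussianTail (-Real.exp (-u ^ 2 / 2)) u := by
  have hc : Continuous fun t : ℝ => Real.exp (-t ^ 2 / 2) := by fun_prop
  have h : gaussianTail = fun v =>
      gaussianTail 0 - ∫ t in (0 : ℝ)..v, Real.exp (-t ^ 2 / 2) := by
    funext v
    rw [← intervalIntegral.integral_Ioi_sub_Ioi' integrable_exp_neg_sq_div_two.integrableOn
      integrable_exp_neg_sq_div_two.integrableOn]
    simp [gaussianTail]
  rw [h]
  exact (hc.integral_hasStrictDerivAt 0 u).hasDerivAt.const_sub _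

lemma gaussianTail_nonneg (u : ℝ) : 0 ≤ gaussianTail u :=
  integral_nonneg fun _ => (Real.exp_pos _).le

lemma gaussianTail_le (u : ℝ) : gaussianTail u ≤ ∫ t : ℝ, Real.exp (-t ^ 2 / 2) :=
  setIntegral_le_integral integrable_exp_neg_sq_div_two
    (Eventually.of_forall fun _ => (Real.exp_pos _).le)

lemma continuous_gaussianTail : Continuous gaussianTail :=
  continuous_iff_continuousAt.2 fun u => (hasDerivAt_gaussianTail u).continuousAt

/-- The bivariate normal density as a marginal density times a conditional density. -/
lemma bivariateNormal_density_eq {s : ℝ} (hs : 0 < 1 - s ^ 2) (x y : ℝ) :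
    (2 * Real.pi * √(1 - s ^ 2))⁻¹ *
        Real.exp (-(x ^ 2 - 2 * s * x * y + y ^ 2) / (2 * (1 - s ^ 2))) =
      (2 * Real.pi)⁻¹ * Real.exp (-x ^ 2 / 2) *
        ((√(1 - s ^ 2))⁻¹ * Real.exp (-((√(1 - s ^ 2))⁻¹ * (y - s * x)) ^ 2 / 2)) := by
  have hexp : -(x ^ 2 - 2 * s * x * y + y ^ 2) / (2 * (1 - s ^ 2)) =
      -x ^ 2 / 2 + -((√(1 - s ^ 2))⁻¹ * (y - s * x)) ^ 2 / 2 := by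
    rw [mul_pow, inv_pow, Real.sq_sqrt hs.le]
    field_simp
    ring
  rw [hexp, Real.exp_add, mul_inv]
  ring

lemma integral_Ioi_comp_mul_sub (g : ℝ → ℝ) (h m : ℝ) {b : ℝ} (hb : 0 < b) :
    ∫ y in Set.Ioi h, b * g (b * (y - m)) = ∫ t in Set.Ioi (b * (h - m)), g t := by
  have h1 := (measurePreserving_sub_right volume m).setIntegral_preimage_emb
    (MeasurableEquiv.subRight m).measurableEmbedding (fun y => g (b * y)) (Set.Ioi (h - m))
  have h2 : (fun y : ℝ => y - m) ⁻¹' Set.Ioi (h - m) = Set.Ioi h := by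
    ext y
    simp
  rw [h2] at h1
  rw [integral_const_mul, h1, ← integral_comp_mul_left_Ioi' g (h - m) hb, smul_eq_mul]

lemma bivariateNormalTail_eq_integral_gaussianTail {s : ℝ} (hs : 0 < 1 - s ^ 2) (h₁ h₂ : ℝ) :
    bivariateNormalTail s h₁ h₂ = ∫ x in Set.Ioi h₁, (2 * Real.pi)⁻¹ * Real.exp (-x ^ 2 / 2) *
      gaussianTail ((√(1 - s ^ 2))⁻¹ * (h₂ - s * x)) := by
  simp only [bivariateNormalTail, bivariateNormal_density_eq hs]
  congr 1 with x
  rw [integral_const_mul]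
  congr 1
  exact integral_Ioi_comp_mul_sub (fun t => Real.exp (-t ^ 2 / 2)) h₂ (s * x)
    (inv_pos.2 (Real.sqrt_pos.2 hs))

lemma hasDerivAt_inv_sqrt_mul_sub {s : ℝ} (hs : 0 < 1 - s ^ 2) (h x : ℝ) :
    HasDerivAt (fun v => (√(1 - v ^ 2))⁻¹ * (h - v * x))
      ((s * h - x) / (√(1 - s ^ 2)) ^ 3) s := by
  have hr := Real.sqrt_pos.2 hs
  have h1 : HasDerivAt (fun v : ℝ => 1 - v ^ 2) (-(2 * s)) s := by
    simpa using (hasDerivAt_pow 2 s).const_sub 1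
  have h2 : HasDerivAt (fun v : ℝ => h - v * x) (-x) s := by
    simpa using ((hasDerivAt_id s).mul_const x).const_sub h
  have hsq : √(1 - s ^ 2) ^ 2 = 1 - s ^ 2 := Real.sq_sqrt hs.le
  refine (((h1.sqrt hs.ne').inv hr.ne').mul h2).congr_deriv ?_
  simp only [Pi.inv_apply]
  generalize √(1 - s ^ 2) = r at *
  field_simp
  rw [hsq]
  ring

lemma hasDerivAt_bivariateNormal_density {s : ℝ} (hs : 0 < 1 - s ^ 2) (h x : ℝ) :
    HasDerivAt (fun z => (2 * Real.pi * √(1 - s ^ 2))⁻¹ *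
        Real.exp (-(z ^ 2 - 2 * s * z * h + h ^ 2) / (2 * (1 - s ^ 2))))
      ((2 * Real.pi)⁻¹ * Real.exp (-x ^ 2 / 2) *
        (Real.exp (-((√(1 - s ^ 2))⁻¹ * (h - s * x)) ^ 2 / 2) *
          ((s * h - x) / (√(1 - s ^ 2)) ^ 3))) x := by
  have hr := Real.sqrt_pos.2 hs
  have hsq : √(1 - s ^ 2) ^ 2 = 1 - s ^ 2 := Real.sq_sqrt hs.le
  have h1 : HasDerivAt (fun z : ℝ => -(z ^ 2 - 2 * s * z * h + h ^ 2) / (2 * (1 - s ^ 2)))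
      ((s * h - x) / (√(1 - s ^ 2)) ^ 2) x := by
    have h2 : HasDerivAt (fun z : ℝ => z ^ 2 - 2 * s * z * h + h ^ 2)
        (2 * x - 2 * s * h) x := by
      simpa using ((hasDerivAt_pow 2 x).sub
        (((hasDerivAt_id x).const_mul (2 * s)).mul_const h)).add_const (h ^ 2)
    refine (h2.neg.div_const (2 * (1 - s ^ 2))).congr_deriv ?_
    rw [hsq]
    field_simp
    ring
  refine (h1.exp.const_mul _).congr_deriv ?_
  rw [← mul_assoc, bivariateNormal_density_eq hs]
  field_simp

lemma tendsto_bivariateNormal_density_atTop {s : ℝ} (hs : 0 < 1 - s ^ 2) (h : ℝ) :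
    Tendsto (fun z => (2 * Real.pi * √(1 - s ^ 2))⁻¹ *
        Real.exp (-(z ^ 2 - 2 * s * z * h + h ^ 2) / (2 * (1 - s ^ 2)))) atTop (𝓝 0) := by
  have hr := Real.sqrt_pos.2 hs
  have hexp : Tendsto (fun z : ℝ => Real.exp (-z ^ 2 / 2)) atTop (𝓝 0) := by
    simp only [neg_div]
    exact Real.tendsto_exp_neg_atTop_nhds_zero.comp
      ((tendsto_pow_atTop two_ne_zero).atTop_div_const two_pos)
  have hlim : Tendsto (fun z : ℝ => (2 * Real.pi)⁻¹ * Real.exp (-z ^ 2 / 2) *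
      ((√(1 - s ^ 2))⁻¹ * 1)) atTop (𝓝 0) := by
    simpa using (hexp.const_mul (2 * Real.pi)⁻¹).mul_const ((√(1 - s ^ 2))⁻¹ * 1)
  refine squeeze_zero (fun z => by positivity) (fun z => ?_) hlim
  rw [bivariateNormal_density_eq hs]
  gcongr
  exact Real.exp_le_one_iff.2 (by rw [neg_div]; exact neg_nonpos.2 (by positivity))

/-- for fixed `h₁, h₂` and `σ ∈ (-1, 1)`, the function `σ ↦ T(σ; h₁, h₂)` is
differentiable with derivative the bivariate normal density at `(h₁, h₂)`, which is
strictly positive. -/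
theorem hasDerivAt_bivariateNormalTail_correlation (h₁ h₂ : ℝ) (σ : ℝ)
    (hσ : σ ∈ Set.Ioo (-1 : ℝ) 1) :
    HasDerivAt (fun s => bivariateNormalTail s h₁ h₂)
      ((2 * Real.pi * Real.sqrt (1 - σ ^ 2))⁻¹ *
        Real.exp (-(h₁ ^ 2 - 2 * σ * h₁ * h₂ + h₂ ^ 2) / (2 * (1 - σ ^ 2)))) σ
    ∧ 0 < (2 * Real.pi * Real.sqrt (1 - σ ^ 2))⁻¹ *
        Real.exp (-(h₁ ^ 2 - 2 * σ * h₁ * h₂ + h₂ ^ 2) / (2 * (1 - σ ^ 2))) := by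
  have hσ' : 0 < 1 - σ ^ 2 := by nlinarith [hσ.1, hσ.2]
  refine ⟨?_, by positivity⟩
  set c := (1 - σ ^ 2) / 2 with hc
  have hc0 : 0 < c := half_pos hσ'
  have hN : {s : ℝ | c < 1 - s ^ 2} ∈ 𝓝 σ :=
    (isOpen_lt continuous_const (by fun_prop)).mem_nhds (half_lt_self hσ')
  have hpos : ∀ s ∈ {s : ℝ | c < 1 - s ^ 2}, 0 < 1 - s ^ 2 := fun s hs => hc0.trans hs
  have hF_cont : ∀ s : ℝ, Continuous fun x : ℝ => (2 * Real.pi)⁻¹ * Real.exp (-x ^ 2 / 2) *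
      gaussianTail ((√(1 - s ^ 2))⁻¹ * (h₂ - s * x)) := fun s =>
    Continuous.mul (by fun_prop) (continuous_gaussianTail.comp (by fun_prop))
  have hbound : Integrable (fun x : ℝ => (2 * Real.pi)⁻¹ * Real.exp (-x ^ 2 / 2) *
      ((|h₂| + |x|) / √c ^ 3)) (volume.restrict (Set.Ioi h₁)) := by
    refine Integrable.integrableOn ?_
    refine (((integrable_exp_neg_sq_div_two.mul_const |h₂|).add
      integrable_mul_exp_neg_sq_div_two.abs).const_mul ((2 * Real.pi)⁻¹ / √c ^ 3)).congr
      (Eventually.of_forall fun x => ?_)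
    simp only [Pi.add_apply, abs_mul, Real.abs_exp]
    ring
  obtain ⟨hint, hderiv⟩ := hasDerivAt_integral_of_dominated_loc_of_deriv_le
    (μ := volume.restrict (Set.Ioi h₁)) hN
    (F := fun s x => (2 * Real.pi)⁻¹ * Real.exp (-x ^ 2 / 2) *
      gaussianTail ((√(1 - s ^ 2))⁻¹ * (h₂ - s * x)))
    (F' := fun s x => (2 * Real.pi)⁻¹ * Real.exp (-x ^ 2 / 2) *
      (-Real.exp (-((√(1 - s ^ 2))⁻¹ * (h₂ - s * x)) ^ 2 / 2) *
        ((s * h₂ - x) / √(1 - s ^ 2) ^ 3)))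
    (Eventually.of_forall fun s => (hF_cont s).aestronglyMeasurable)
    (((integrable_exp_neg_sq_div_two.const_mul (2 * Real.pi)⁻¹).mul_bdd
      (c := ∫ t : ℝ, Real.exp (-t ^ 2 / 2))
      (continuous_gaussianTail.comp (by fun_prop)).aestronglyMeasurable
      (Eventually.of_forall fun x => by
        simpa [abs_of_nonneg (gaussianTail_nonneg _)] using gaussianTail_le _)).integrableOn)
    (Continuous.aestronglyMeasurable (by fun_prop))
    (Eventually.of_forall fun x s hs => by
      have hs0 := hpos s hs
      have hs1 : |s| ≤ 1 := by
        rw [← sq_le_one_iff_abs_le_one]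
        linarith
      have he : Real.exp (-((√(1 - s ^ 2))⁻¹ * (h₂ - s * x)) ^ 2 / 2) ≤ 1 :=
        Real.exp_le_one_iff.2 (by rw [neg_div]; exact neg_nonpos.2 (by positivity))
      have hn : |s * h₂ - x| ≤ |h₂| + |x| := by
        refine (abs_sub _ _).trans ?_
        rw [abs_mul]
        gcongr
        exact mul_le_of_le_one_left (abs_nonneg _) hs1
      have hsc : √c ^ 3 ≤ √(1 - s ^ 2) ^ 3 := by
        gcongr
        exact le_of_lt hs
      have hq : |s * h₂ - x| / √(1 - s ^ 2) ^ 3 ≤ (|h₂| + |x|) / √c ^ 3 := by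
        gcongr
      have hr3 : 0 < √(1 - s ^ 2) ^ 3 := pow_pos (Real.sqrt_pos.2 hs0) 3
      rw [Real.norm_eq_abs, abs_mul,
        abs_of_pos (by positivity : 0 < (2 * Real.pi)⁻¹ * Real.exp (-x ^ 2 / 2)),
        abs_mul, abs_neg, Real.abs_exp, abs_div, abs_of_pos hr3]
      refine mul_le_mul_of_nonneg_left ?_ (by positivity)
      exact (mul_le_of_le_one_left (by positivity) he).trans hq)
    hbound
    (Eventually.of_forall fun x s hs =>
      ((hasDerivAt_gaussianTail _).comp s
        (hasDerivAt_inv_sqrt_mul_sub (hpos s hs) h₂ x)).const_mul _)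
  refine (hderiv.congr_deriv ?_).congr_of_eventuallyEq ?_
  · rw [integral_Ioi_of_hasDerivAt_of_tendsto' (m := -0)
      (fun x _ => ((hasDerivAt_bivariateNormal_density hσ' h₂ x).neg.congr_deriv (by ring)))
      hint (tendsto_bivariateNormal_density_atTop hσ' h₂).neg]
    simp
  · filter_upwards [hN] with s hs
    exact bivariateNormalTail_eq_integral_gaussianTail (hpos s hs) h₁ h₂
end
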